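/- arXiv:2205.08705 — 2 statements merged into one kernel-verified Lean document; each statement's English description precedes it below -/
import Mathlib

section
/- Let A₁, A₂ : Matrix (Fin n) (Fin n) ℝ be symmetric adjacency matrices of two r-regular signed graphs (entries in {-1, 0, 1}, zero diagonal, and each row of each Aₗ has exactly r nonzero entries) that are cospectral: charpoly(A₁) = charpoly(A₂). Let B₁, B₂ : Matrix (Fin n) (Fin m) ℝ be incidence matrices of these signed graphs, so that Bₗ * Bₗᵀ = (r : ℝ) • 1 - Aₗ for l = 1, 2. Then for every positive integer p, charpoly(M_p B₁) = charpoly(M_p B₂), i.e. the signed graphs S_p(Γ₁) and S_p(Γ₂) are cospectral. -/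
open Matrix

/-- `B` is an incidence matrix of a signed graph: each column has exactly two
nonzero entries, each equal to `1` or `-1`. -/
def IsIncidence {n m : ℕ} (B : Matrix (Fin n) (Fin m) ℝ) : Prop :=
  ∀ j : Fin m, ∃ a b : Fin n, a ≠ b ∧
    (B a j = 1 ∨ B a j = -1) ∧ (B b j = 1 ∨ B b j = -1) ∧
    ∀ c : Fin n, c ≠ a → c ≠ b → B c j = 0

/-- Adjacency matrix of the signed graph `S_p(Γ)` of Operation 4.1, built from an
incidence matrix `B` of `Γ`. -/
def Mp {n m : ℕ} (p : ℕ) (B : Matrix (Fin n) (Fin m) ℝ) :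
    Matrix (Fin n ⊕ (Fin p × Fin m)) (Fin n ⊕ (Fin p × Fin m)) ℝ :=
  Matrix.of fun x y =>
    match x, y with
    | Sum.inl i, Sum.inr aj => B i aj.2
    | Sum.inr aj, Sum.inl i => B i aj.2
    | _, _ => 0

namespace Matrix

open Polynomial

/-- The characteristic polynomial of an off-diagonal block matrix, in terms of that of the product
of its two blocks. -/
theorem charpoly_fromBlocks_zero_diag_mul_X_pow {R k l : Type*} [CommRing R]
    [Fintype k] [DecidableEq k] [Fintype l] [DecidableEq l]
    (C : Matrix k l R) (D : Matrix l k R) :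
    (fromBlocks 0 C D 0).charpoly * X ^ Fintype.card k =
      (C * D).charpoly.comp (X ^ 2) * X ^ Fintype.card l := by
  let C' : Matrix k l R[X] := C.map Polynomial.C
  let D' : Matrix l k R[X] := D.map Polynomial.C
  have hleft : (fromBlocks 0 C D 0).charpoly =
      (fromBlocks (scalar k X) (-C') (-D') (scalar l X)).det := by
    rw [charpoly, charmatrix_fromBlocks]
    simp [charmatrix, C', D']
  have hright : (C * D).charpoly.comp (X ^ 2) = (scalar k (X ^ 2 : R[X]) - C' * D').det := by
    rw [charpoly, ← coe_compRingHom_apply, RingHom.map_det]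
    congr 1
    ext1 i j
    by_cases h : i = j
    · subst h
      simp [C', D', mul_apply]
    · simp [C', D', mul_apply, h]
  have hmul : fromBlocks (scalar k X) (-C') (-D') (scalar l X) *
      fromBlocks (scalar k X) 0 D' 1 =
      fromBlocks (scalar k (X ^ 2 : R[X]) - C' * D') (-C') 0 (scalar l X) := by
    rw [fromBlocks_multiply]
    congr 1
    · simp [pow_two, sub_eq_add_neg]
    · simp
    · rw [Matrix.neg_mul, ← scalar_comm_iff.mpr (by ext; simp [mul_comm]), neg_add_cancel]
    · simp
  have hdet := congrArg det hmul
  rw [det_mul, det_fromBlocks_zero₁₂, det_fromBlocks_zero₂₁] at hdet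
  rw [hleft, hright]
  simpa using hdet

/-- An invertible affine change of a matrix acts on its characteristic polynomial by a change of
variables. -/
theorem eval_charpoly_smul_smul_one_sub {K k : Type*} [Field K] [Fintype k] [DecidableEq k]
    (A : Matrix k k K) (c r s : K) (hc : c ≠ 0) :
    (c • (r • 1 - A)).charpoly.eval s = (-c) ^ Fintype.card k * A.charpoly.eval (r - s / c) := by
  rw [eval_charpoly, eval_charpoly, ← det_smul]
  congr 1
  ext i j
  by_cases h : i = j
  · subst h
    simp
    field_simp
    ring
  · simp [h]

end Matrix

theorem Mp_eq_fromBlocks {n m : ℕ} (p : ℕ) (B : Matrix (Fin n) (Fin m) ℝ) :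
    Mp p B = fromBlocks 0 (B.submatrix id Prod.snd) (B.submatrix id Prod.snd)ᵀ 0 := by
  ext (_ | _) (_ | _) <;> rfl

theorem submatrix_snd_mul_transpose {n m : ℕ} (p : ℕ) (B : Matrix (Fin n) (Fin m) ℝ) :
    B.submatrix id (Prod.snd : Fin p × Fin m → Fin m) *
        (B.submatrix id (Prod.snd : Fin p × Fin m → Fin m))ᵀ =
      (p : ℝ) • (B * Bᵀ) := by
  ext i j
  simp [mul_apply, Fintype.sum_prod_type]

/-- Corollary 4.6(i): if `Γ₁` and `Γ₂` are cospectral non-isomorphic `r`-regular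
signed graphs (with adjacency matrices `A₁, A₂` and incidence matrices `B₁, B₂`,
so `Bₗ Bₗᵀ = r • 1 - Aₗ`), then `S_p(Γ₁)` and `S_p(Γ₂)` are cospectral. -/
theorem Mp_cospectral_of_regular_cospectral {n m r : ℕ}
    (A₁ A₂ : Matrix (Fin n) (Fin n) ℝ)
    (hs₁ : A₁.IsSymm) (hs₂ : A₂.IsSymm)
    (he₁ : ∀ i j, A₁ i j = 1 ∨ A₁ i j = 0 ∨ A₁ i j = -1)
    (he₂ : ∀ i j, A₂ i j = 1 ∨ A₂ i j = 0 ∨ A₂ i j = -1)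
    (hd₁ : ∀ i, A₁ i i = 0) (hd₂ : ∀ i, A₂ i i = 0)
    (hr₁ : ∀ i, (Finset.univ.filter (fun j => A₁ i j ≠ 0)).card = r)
    (hr₂ : ∀ i, (Finset.univ.filter (fun j => A₂ i j ≠ 0)).card = r)
    (hA : A₁.charpoly = A₂.charpoly)
    (B₁ B₂ : Matrix (Fin n) (Fin m) ℝ)
    (hB₁ : IsIncidence B₁) (hB₂ : IsIncidence B₂)
    (hL₁ : B₁ * B₁ᵀ = (r : ℝ) • (1 : Matrix (Fin n) (Fin n) ℝ) - A₁)
    (hL₂ : B₂ * B₂ᵀ = (r : ℝ) • (1 : Matrix (Fin n) (Fin n) ℝ) - A₂)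
    (p : ℕ) (hp : 0 < p) :
    (Mp p B₁).charpoly = (Mp p B₂).charpoly := by
  have hp' : (p : ℝ) ≠ 0 := Nat.cast_ne_zero.mpr hp.ne'
  have hcharpoly : ((p : ℝ) • (B₁ * B₁ᵀ)).charpoly = ((p : ℝ) • (B₂ * B₂ᵀ)).charpoly :=
    Polynomial.funext fun s => by
      rw [hL₁, hL₂, eval_charpoly_smul_smul_one_sub _ _ _ _ hp',
        eval_charpoly_smul_smul_one_sub _ _ _ _ hp', hA]
  refine mul_right_cancel₀ (pow_ne_zero (Fintype.card (Fin n)) Polynomial.X_ne_zero) ?_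
  rw [Mp_eq_fromBlocks, Mp_eq_fromBlocks, charpoly_fromBlocks_zero_diag_mul_X_pow,
    charpoly_fromBlocks_zero_diag_mul_X_pow, submatrix_snd_mul_transpose,
    submatrix_snd_mul_transpose, hcharpoly]
end

section
/- Let A₁, A₂ : Matrix (Fin n) (Fin n) ℝ be symmetric adjacency matrices of two r-regular signed graphs (entries in {-1, 0, 1}, zero diagonal, and each row of each Aₗ has exactly r nonzero entries) that are cospectral: charpoly(A₁) = charpoly(A₂). Let B₁, B₂ : Matrix (Fin n) (Fin m) ℝ be incidence matrices of these signed graphs, so that Bₗ * Bₗᵀ = (r : ℝ) • 1 - Aₗ for l = 1, 2. Then for every positive integer p and k = p or k = p - 1, charpoly(N_{p,k} B₁) = charpoly(N_{p,k} B₂), i.e. the signed graphs S_p^k(Γ₁) and S_p^k(Γ₂) are cospectral. -/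
open Matrix

/-- Adjacency matrix of the signed graph `S_p^k(Γ)` of Operation 4.2, built from an
incidence matrix `B` of `Γ`. -/
def Npk {n m : ℕ} (p k : ℕ) (B : Matrix (Fin n) (Fin m) ℝ) :
    Matrix ((Fin (p + 1) × Fin n) ⊕ (Fin (k + 1) × Fin m))
      ((Fin (p + 1) × Fin n) ⊕ (Fin (k + 1) × Fin m)) ℝ :=
  Matrix.of fun x y =>
    match x, y with
    | Sum.inl ai, Sum.inr bj => B ai.2 bj.2
    | Sum.inr bj, Sum.inl ai => B ai.2 bj.2
    | _, _ => 0

/-- The `q` stacked copies of the identity matrix. -/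
def stackOne (q n : ℕ) : Matrix (Fin q × Fin n) (Fin n) ℝ :=
  Matrix.of fun x i => if x.2 = i then 1 else 0

lemma stackOne_transpose_mul_self (q n : ℕ) :
    (stackOne q n)ᵀ * stackOne q n = (q : ℝ) • (1 : Matrix (Fin n) (Fin n) ℝ) := by
  ext i j
  simp [Matrix.mul_apply, stackOne, Fintype.sum_prod_type, Matrix.one_apply, eq_comm,
    apply_ite Finset.card, Nat.cast_ite]

lemma Npk_eq_fromBlocks {n m : ℕ} (p k : ℕ) (B : Matrix (Fin n) (Fin m) ℝ) :
    Npk p k B = fromBlocks 0 (stackOne (p + 1) n * B * (stackOne (k + 1) m)ᵀ)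
      (stackOne (p + 1) n * B * (stackOne (k + 1) m)ᵀ)ᵀ 0 := by
  ext (x | x) (y | y) <;> simp [Npk, stackOne, Matrix.mul_apply]

lemma det_one_sub_smul_fromBlocks {α β : Type*} [Fintype α] [Fintype β] [DecidableEq α]
    [DecidableEq β] (s : ℝ) (C : Matrix α β ℝ) :
    (1 - s • fromBlocks 0 C Cᵀ 0).det = (1 - s ^ 2 • (C * Cᵀ)).det := by
  have h : (1 - s • fromBlocks 0 C Cᵀ 0 : Matrix (α ⊕ β) (α ⊕ β) ℝ) =
      fromBlocks 1 (-(s • C)) (-(s • Cᵀ)) 1 := by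
    rw [← fromBlocks_one, fromBlocks_smul, sub_eq_add_neg, fromBlocks_neg, fromBlocks_add]
    simp
  rw [h, det_fromBlocks_one₂₂]
  simp [smul_smul, pow_two]

lemma det_one_sub_smul_Npk {n m : ℕ} (p k : ℕ) (B : Matrix (Fin n) (Fin m) ℝ) (s : ℝ) :
    (1 - s • Npk p k B).det =
      (1 - (s ^ 2 * (k + 1) * (p + 1)) • (B * Bᵀ)).det := by
  rw [Npk_eq_fromBlocks, det_one_sub_smul_fromBlocks]
  have h : (stackOne (p + 1) n * B * (stackOne (k + 1) m)ᵀ) *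
      (stackOne (p + 1) n * B * (stackOne (k + 1) m)ᵀ)ᵀ =
      ((k + 1 : ℕ) : ℝ) • (stackOne (p + 1) n * (B * Bᵀ * (stackOne (p + 1) n)ᵀ)) := by
    calc _ = stackOne (p + 1) n * (B * ((stackOne (k + 1) m)ᵀ * stackOne (k + 1) m) * Bᵀ *
          (stackOne (p + 1) n)ᵀ) := by
          simp only [transpose_mul, transpose_transpose, Matrix.mul_assoc]
      _ = _ := by rw [stackOne_transpose_mul_self]; simp
  rw [h, smul_smul, ← Matrix.mul_smul, det_one_sub_mul_comm, Matrix.smul_mul, Matrix.mul_assoc,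
    stackOne_transpose_mul_self]
  simp [smul_smul]

lemma det_scalar_sub {α : Type*} [Fintype α] [DecidableEq α] {t : ℝ} (ht : t ≠ 0)
    (M : Matrix α α ℝ) :
    (scalar α t - M).det = t ^ Fintype.card α * (1 - t⁻¹ • M).det := by
  rw [← det_smul, smul_sub, smul_smul, mul_inv_cancel₀ ht, one_smul, smul_one_eq_diagonal]
  rfl

lemma det_one_sub_smul_sub {α : Type*} [Fintype α] [DecidableEq α] {d : ℝ} (hd : d ≠ 0)
    (r : ℝ) (A : Matrix α α ℝ) :
    (1 - d • (r • (1 : Matrix α α ℝ) - A)).det =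
      (-d) ^ Fintype.card α * A.charpoly.eval (r - d⁻¹) := by
  rw [eval_charpoly, ← det_smul]
  congr 1
  have h : scalar α (r - d⁻¹) = (r - d⁻¹) • (1 : Matrix α α ℝ) := by
    rw [smul_one_eq_diagonal]; rfl
  rw [h]
  simp only [smul_sub, sub_smul, smul_smul, neg_mul, mul_inv_cancel₀ hd, neg_smul, one_smul]
  abel

/-- Corollary 4.6(ii): if `Γ₁` and `Γ₂` are cospectral `r`-regular signed graphs
(with adjacency matrices `A₁, A₂` and incidence matrices `B₁, B₂`, so
`Bₗ Bₗᵀ = r • 1 - Aₗ`), then `S_p^k(Γ₁)` and `S_p^k(Γ₂)` are cospectral for `k = p`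
or `k = p - 1`. -/
theorem Npk_cospectral_of_regular_cospectral {n m r : ℕ}
    (A₁ A₂ : Matrix (Fin n) (Fin n) ℝ)
    (hs₁ : A₁.IsSymm) (hs₂ : A₂.IsSymm)
    (he₁ : ∀ i j, A₁ i j = 1 ∨ A₁ i j = 0 ∨ A₁ i j = -1)
    (he₂ : ∀ i j, A₂ i j = 1 ∨ A₂ i j = 0 ∨ A₂ i j = -1)
    (hd₁ : ∀ i, A₁ i i = 0) (hd₂ : ∀ i, A₂ i i = 0)
    (hr₁ : ∀ i, (Finset.univ.filter (fun j => A₁ i j ≠ 0)).card = r)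
    (hr₂ : ∀ i, (Finset.univ.filter (fun j => A₂ i j ≠ 0)).card = r)
    (hA : A₁.charpoly = A₂.charpoly)
    (B₁ B₂ : Matrix (Fin n) (Fin m) ℝ)
    (hB₁ : IsIncidence B₁) (hB₂ : IsIncidence B₂)
    (hL₁ : B₁ * B₁ᵀ = (r : ℝ) • (1 : Matrix (Fin n) (Fin n) ℝ) - A₁)
    (hL₂ : B₂ * B₂ᵀ = (r : ℝ) • (1 : Matrix (Fin n) (Fin n) ℝ) - A₂)
    (p k : ℕ) (hp : 0 < p) (hk : k = p ∨ k = p - 1) :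
    (Npk p k B₁).charpoly = (Npk p k B₂).charpoly := by
  refine mul_left_cancel₀ Polynomial.X_ne_zero (Polynomial.funext fun t => ?_)
  rcases eq_or_ne t 0 with rfl | ht
  · simp
  · have hd : t⁻¹ ^ 2 * ((k : ℝ) + 1) * (p + 1) ≠ 0 := by positivity
    rw [Polynomial.eval_mul, Polynomial.eval_mul, eval_charpoly, eval_charpoly,
      det_scalar_sub ht, det_scalar_sub ht, det_one_sub_smul_Npk, det_one_sub_smul_Npk, hL₁, hL₂,
      det_one_sub_smul_sub hd, det_one_sub_smul_sub hd, hA]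
end
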